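/- Let n ≥ 5 and s be integers with 2 ≤ s ≤ ⌊(n−1)/2⌋. Then diam(C_n(1,s)) ≤ min( max(⌊n/s⌋+1, n − ⌊n/s⌋·s − 2, (⌊n/s⌋+1)·s − n − 1), ⌊(n+2)/4⌋, ⌊⌊n/2⌋/s⌋ + ⌈s/2⌉ ). -/

import Mathlib

open SimpleGraph

lemma edist_circulantGraph_add_nsmul_le {A : Type*} [AddCommGroup A] {S : Set A} {g : A}
    (hg : g ∈ S) (u : A) (k : ℕ) : (circulantGraph S).edist u (u + k • g) ≤ k := by
  induction k with
  | zero => simp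
  | succ k ih =>
    have step : (circulantGraph S).edist (u + k • g) (u + (k + 1) • g) ≤ 1 := by
      rw [edist_le_one_iff_adj_or_eq]
      by_cases h : u + k • g = u + (k + 1) • g
      · exact Or.inr h
      · refine Or.inl ?_
        rw [circulantGraph_adj]
        refine ⟨h, Or.inr ?_⟩
        simpa [add_smul, add_sub_add_left_eq_sub] using hg
    calc _ ≤ _ := SimpleGraph.edist_triangle (v := u + k • g)
      _ ≤ (k : ℕ∞) + 1 := add_le_add ih step
      _ = _ := by push_cast; rfl

lemma edist_circulantGraph_add_zsmul_le {A : Type*} [AddCommGroup A] {S : Set A} {g : A}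
    (hg : g ∈ S) (u : A) (k : ℤ) : (circulantGraph S).edist u (u + k • g) ≤ k.natAbs := by
  obtain ⟨m, rfl | rfl⟩ := k.eq_nat_or_neg
  · simpa using edist_circulantGraph_add_nsmul_le hg u m
  · have := edist_circulantGraph_add_nsmul_le hg (u + (-(m : ℤ)) • g) m
    rw [SimpleGraph.edist_comm] at this
    simpa using this

lemma edist_circulantGraph_one_le {n s : ℕ} {u v : ZMod n} {x y : ℤ} {c : ℕ}
    (h : v - u = x + y * s) (hc : x.natAbs + y.natAbs ≤ c) :
    (circulantGraph ({1, (s : ZMod n)} : Set (ZMod n))).edist u v ≤ c := by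
  have hx := edist_circulantGraph_add_zsmul_le (S := {1, (s : ZMod n)}) (g := 1) (by simp) u x
  have hy := edist_circulantGraph_add_zsmul_le (S := {1, (s : ZMod n)}) (g := (s : ZMod n))
    (by simp) (u + x • 1) y
  have hv : u + x • (1 : ZMod n) + y • (s : ZMod n) = v := by
    rw [sub_eq_iff_eq_add'] at h
    simp [h, add_assoc]
  rw [hv] at hy
  calc _ ≤ _ := SimpleGraph.edist_triangle (v := u + x • (1 : ZMod n))
    _ ≤ (x.natAbs : ℕ∞) + y.natAbs := add_le_add hx hy
    _ ≤ c := by exact_mod_cast hc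

/-- `w` is, modulo `n`, a combination `x + y * s` of size `|x| + |y|` at most
`max (n / s + 1) (max (r - 2) (s - r - 1))`, where `r = n % s`. -/
lemma exists_repr_le_max {n s w : ℕ} (hs : 2 ≤ s) (hw : w < n) :
    ∃ x y k : ℤ, (w : ℤ) = x + y * s + k * n ∧ x.natAbs + y.natAbs ≤
      max (n / s + 1) (max (n - (n / s) * s - 2) ((n / s + 1) * s - n - 1)) := by
  have hn := Nat.div_add_mod' n s
  have hr := Nat.mod_lt n (by omega : s > 0)
  have hwd := Nat.div_add_mod' w s
  have hb := Nat.mod_lt w (by omega : s > 0)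
  have haq : w / s ≤ n / s := Nat.div_le_div_right hw.le
  rw [add_mul, one_mul]
  set q := n / s
  set r := n % s
  set a := w / s
  set b := w % s
  clear_value q r a b
  have hab : a = q → b ≤ r := by intro h; rw [h] at hwd; omega
  have hn' : (q : ℤ) * s + r = n := by exact_mod_cast hn
  have hwd' : (a : ℤ) * s + b = w := by exact_mod_cast hwd
  by_cases hbr : b ≤ r
  · by_cases h : a + b ≤ q - a + (r - b)
    · exact ⟨b, a, 0, by linarith, by omega⟩
    · exact ⟨b - r, a - q, 1, by linear_combination hn' - hwd', by omega⟩
  · by_cases h : a + 1 + (s - b) ≤ q - a + (b - r)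
    · exact ⟨b - s, a + 1, 0, by linear_combination - hwd', by omega⟩
    · exact ⟨b - r, a - q, 1, by linear_combination hn' - hwd', by omega⟩

lemma exists_repr_le_min_of_le_half {n s w : ℕ} (hs2 : 2 ≤ s) (hs : s ≤ n / 2)
    (hw : w ≤ n / 2) :
    ∃ x y : ℤ, (w : ℤ) = x + y * s ∧
      x.natAbs + y.natAbs ≤ min ((n + 2) / 4) (n / 2 / s + (s + 1) / 2) := by
  have hwd := Nat.div_add_mod' w s
  have hb := Nat.mod_lt w (by omega : s > 0)
  have ham : w / s ≤ n / 2 / s := Nat.div_le_div_right hw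
  set a := w / s
  set b := w % s
  clear_value a b
  have key : 1 ≤ a → 2 * a + b ≤ a * s + 1 := by
    intro h
    obtain ⟨t, rfl⟩ := Nat.exists_eq_add_of_le hs2
    nlinarith
  have h0 : a = 0 → a * s = 0 := by intro h; simp [h]
  have hwd' : (a : ℤ) * s + b = w := by exact_mod_cast hwd
  by_cases h : 2 * b ≤ s + 1
  · exact ⟨b, a, by linarith, by omega⟩
  · exact ⟨b - s, a + 1, by linear_combination - hwd', by omega⟩

/-- For all `n` and `s`:
`diam(C_n(1,s)) ≤ min(max(⌊n/s⌋+1, n-⌊n/s⌋s-2, (⌊n/s⌋+1)s-n-1), ⌊(n+2)/4⌋, ⌊⌊n/2⌋/s⌋+⌈s/2⌉)`. -/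
theorem diam_circulant_le_min (n s : ℕ) (hn : 5 ≤ n) (hs2 : 2 ≤ s) (hs : s ≤ (n - 1) / 2) :
    (circulantGraph ({1, (s : ZMod n)} : Set (ZMod n))).diam ≤
      min (max (n / s + 1) (max (n - (n / s) * s - 2) ((n / s + 1) * s - n - 1)))
        (min ((n + 2) / 4) (n / 2 / s + (s + 1) / 2)) := by
  have hn0 : NeZero n := ⟨by omega⟩
  have hdiff (u v : ZMod n) : v - u = ((v - u).val : ZMod n) := (ZMod.natCast_zmod_val _).symm
  have hmax (u v : ZMod n) : (circulantGraph ({1, (s : ZMod n)} : Set (ZMod n))).edist u v ≤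
      (max (n / s + 1) (max (n - (n / s) * s - 2) ((n / s + 1) * s - n - 1)) : ℕ) := by
    obtain ⟨x, y, k, h, hc⟩ := exists_repr_le_max hs2 (v - u).val_lt
    refine edist_circulantGraph_one_le ?_ hc
    rw [hdiff]
    simpa using congrArg (Int.cast : ℤ → ZMod n) h
  have hmin (u v : ZMod n) (huv : (v - u).val ≤ n / 2) :
      (circulantGraph ({1, (s : ZMod n)} : Set (ZMod n))).edist u v ≤
        (min ((n + 2) / 4) (n / 2 / s + (s + 1) / 2) : ℕ) := by
    obtain ⟨x, y, h, hc⟩ := exists_repr_le_min_of_le_half hs2 (by omega) huv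
    refine edist_circulantGraph_one_le ?_ hc
    rw [hdiff]
    simpa using congrArg (Int.cast : ℤ → ZMod n) h
  refine ENat.toNat_le_of_le_natCast (ediam_le_of_edist_le fun u v ↦ ?_)
  rw [Nat.mono_cast.map_min]
  refine le_min (hmax u v) ?_
  by_cases huv : (v - u).val ≤ n / 2
  · exact hmin u v huv
  · rw [SimpleGraph.edist_comm]
    refine hmin v u ?_
    rw [← neg_sub v u, ZMod.neg_val]
    split_ifs <;> omega
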